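/- For every finite set S of points in the closed Euclidean unit disk {x ∈ ℝ² : ‖x‖₂ ≤ 1}, there exists a wake-up tree for S rooted at the origin, with edge lengths measured by the Euclidean norm on ℝ², whose makespan is at most 5.4162. -/

import Mathlib

/-- `IsWakeUpTree d p₀ S parent t` : `parent` encodes a rooted spanning tree on the node
node set `{p₀} ∪ S` (each non-root node has a parent among the nodes and reaches the root
by iterating `parent`), the root `p₀` has exactly one child (when there is a non-root
node), every non-root node has at most two children, and `t v` is the sum of the
`d`-distances along the tree path from `p₀` to `v` (so the makespan of the tree is the
maximum of `t` over the nodes). -/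
def IsWakeUpTree {X : Type*} (d : X → X → ℝ) (p₀ : X) (S : Finset X)
    (parent : X → X) (t : X → ℝ) : Prop :=
  t p₀ = 0 ∧
  (∀ p ∈ S, p ≠ p₀ →
      (parent p = p₀ ∨ parent p ∈ S) ∧
      t p = t (parent p) + d (parent p) p ∧
      ∃ n : ℕ, parent^[n] p = p₀) ∧
  -- the root has at most one child
  (∀ x ∈ S, x ≠ p₀ → parent x = p₀ →
      ∀ y ∈ S, y ≠ p₀ → parent y = p₀ → x = y) ∧
  -- the root has a child as soon as there is a non-root node
  ((∃ p ∈ S, p ≠ p₀) → ∃ c ∈ S, c ≠ p₀ ∧ parent c = p₀) ∧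
  -- every non-root node has at most two children
  (∀ q ∈ S, q ≠ p₀ → ∀ x ∈ S, ∀ y ∈ S, ∀ z ∈ S,
      x ≠ p₀ → y ≠ p₀ → z ≠ p₀ →
      parent x = q → parent y = q → parent z = q →
      x = y ∨ x = z ∨ y = z)

/-- `IsBranch q τ B T parent t` : `parent` encodes a tree rooted at `q` with node set
`{q} ∪ T` in which `q` has at most one child and every other node at most two, reached at
time `τ` at the root and at time `t v ≤ B` at every other node `v`. -/
structure IsBranch {X : Type*} [MetricSpace X] (q : X) (τ B : ℝ) (T : Finset X)
    (parent : X → X) (t : X → ℝ) : Prop where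
  root : t q = τ
  mem : ∀ p ∈ T, parent p = q ∨ parent p ∈ T
  time : ∀ p ∈ T, t p = t (parent p) + dist (parent p) p
  ind : ∀ C : Set X, q ∈ C → (∀ p ∈ T, parent p ∈ C → p ∈ C) → ∀ p ∈ T, p ∈ C
  one : ∀ x ∈ T, ∀ y ∈ T, parent x = q → parent y = q → x = y
  two : ∀ c ∈ T, ∀ x ∈ T, ∀ y ∈ T, ∀ z ∈ T, parent x = c → parent y = c → parent z = c →
    x = y ∨ x = z ∨ y = z
  le : ∀ p ∈ T, t p ≤ B

/-- `T` can be woken from `q`, starting at time `τ`, no later than time `B`. -/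
def Wakeable {X : Type*} [MetricSpace X] (q : X) (τ B : ℝ) (T : Finset X) : Prop :=
  ∃ parent t, IsBranch q τ B T parent t

section Tree

variable {X : Type*} [MetricSpace X]

lemma wakeable_empty (q : X) (τ B : ℝ) : Wakeable q τ B ∅ :=
  ⟨id, fun _ => τ, by constructor <;> simp⟩

lemma Wakeable.mono {q : X} {τ B B' : ℝ} {T : Finset X} (h : Wakeable q τ B T) (hB : B ≤ B') :
    Wakeable q τ B' T := by
  obtain ⟨f, t, h⟩ := h
  exact ⟨f, t, h.root, h.mem, h.time, h.ind, h.one, h.two, fun p hp => (h.le p hp).trans hB⟩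

/-- The robot at `q` wakes `r`; then two robots leave `r`, one for `T₁` and one for `T₂`. -/
lemma Wakeable.join [DecidableEq X] {q r : X} {τ B : ℝ} {T₁ T₂ : Finset X}
    (h₁ : Wakeable r (τ + dist q r) B T₁) (h₂ : Wakeable r (τ + dist q r) B T₂)
    (hqr : q ≠ r) (hq₁ : q ∉ T₁) (hq₂ : q ∉ T₂) (hr₁ : r ∉ T₁) (hr₂ : r ∉ T₂)
    (hd : Disjoint T₁ T₂) (hB : τ + dist q r ≤ B) :
    Wakeable q τ B (insert r (T₁ ∪ T₂)) := by
  obtain ⟨f₁, t₁, h₁⟩ := h₁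
  obtain ⟨f₂, t₂, h₂⟩ := h₂
  have hd' : ∀ x ∈ T₁, x ∉ T₂ := fun x h h' => Finset.disjoint_left.mp hd h h'
  set f : X → X := fun x => if x ∈ T₁ then f₁ x else if x ∈ T₂ then f₂ x else q with hf
  set t : X → ℝ := fun x => if x ∈ T₁ then t₁ x else if x ∈ T₂ then t₂ x else
    if x = r then τ + dist q r else τ with ht
  have hf₁ : ∀ x ∈ T₁, f x = f₁ x := fun x hx => by simp [hf, hx]
  have hf₂ : ∀ x ∈ T₂, f x = f₂ x := fun x hx => by
    have : x ∉ T₁ := fun h => hd' x h hx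
    simp [hf, hx, this]
  have hfr : f r = q := by simp [hf, hr₁, hr₂]
  have ht₁ : ∀ x ∈ T₁, t x = t₁ x := fun x hx => by simp [ht, hx]
  have ht₂ : ∀ x ∈ T₂, t x = t₂ x := fun x hx => by
    have : x ∉ T₁ := fun h => hd' x h hx
    simp [ht, hx, this]
  have htr : t r = τ + dist q r := by simp [ht, hr₁, hr₂]
  have htq : t q = τ := by simp [ht, hq₁, hq₂, hqr]
  have hm₁ := h₁.mem
  have hm₂ := h₂.mem
  have ho₁ := h₁.one
  have ho₂ := h₂.one
  have hw₁ := h₁.two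
  have hw₂ := h₂.two
  clear_value f t
  clear hf ht
  refine ⟨f, t, htq, ?_, ?_, ?_, ?_, ?_, ?_⟩
  · intro p hp
    simp only [Finset.mem_insert, Finset.mem_union] at hp ⊢
    grind
  · intro p hp
    simp only [Finset.mem_insert, Finset.mem_union] at hp
    have hr₁' := h₁.root
    have hr₂' := h₂.root
    rcases hp with rfl | hp | hp
    · rw [htr, hfr, htq]
    · rw [ht₁ p hp, hf₁ p hp, h₁.time p hp]
      rcases hm₁ p hp with h | h
      · rw [h, hr₁', htr]
      · rw [ht₁ _ h]
    · rw [ht₂ p hp, hf₂ p hp, h₂.time p hp]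
      rcases hm₂ p hp with h | h
      · rw [h, hr₂', htr]
      · rw [ht₂ _ h]
  · intro C hqC hC p hp
    simp only [Finset.mem_insert, Finset.mem_union] at hp hC
    have hrC : r ∈ C := hC r (Or.inl rfl) (by rwa [hfr])
    rcases hp with rfl | hp | hp
    · exact hrC
    · exact h₁.ind C hrC (fun p hp h => hC p (by simp [hp]) (by rwa [hf₁ p hp])) p hp
    · exact h₂.ind C hrC (fun p hp h => hC p (by simp [hp]) (by rwa [hf₂ p hp])) p hp
  · intro x hx y hy
    simp only [Finset.mem_insert, Finset.mem_union] at hx hy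
    grind
  · intro c hc x hx y hy z hz hxc hyc hzc
    simp only [Finset.mem_insert, Finset.mem_union] at hc hx hy hz
    rcases hc with rfl | hc | hc
    · have side : ∀ x, (x = c ∨ x ∈ T₁ ∨ x ∈ T₂) → f x = c →
          (x ∈ T₁ ∧ f₁ x = c) ∨ (x ∈ T₂ ∧ f₂ x = c) := by
        rintro x (rfl | hx | hx) hxc
        · exact absurd (hfr.symm.trans hxc) hqr
        · exact Or.inl ⟨hx, (hf₁ x hx).symm.trans hxc⟩
        · exact Or.inr ⟨hx, (hf₂ x hx).symm.trans hxc⟩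
      rcases side x hx hxc with ⟨hx, hx'⟩ | ⟨hx, hx'⟩ <;>
      rcases side y hy hyc with ⟨hy, hy'⟩ | ⟨hy, hy'⟩ <;>
      rcases side z hz hzc with ⟨hz, hz'⟩ | ⟨hz, hz'⟩
      · exact Or.inl (ho₁ x hx y hy hx' hy')
      · exact Or.inl (ho₁ x hx y hy hx' hy')
      · exact Or.inr (Or.inl (ho₁ x hx z hz hx' hz'))
      · exact Or.inr (Or.inr (ho₂ y hy z hz hy' hz'))
      · exact Or.inr (Or.inr (ho₁ y hy z hz hy' hz'))
      · exact Or.inr (Or.inl (ho₂ x hx z hz hx' hz'))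
      · exact Or.inl (ho₂ x hx y hy hx' hy')
      · exact Or.inl (ho₂ x hx y hy hx' hy')
    · have hc' : c ∉ T₂ := hd' c hc
      have side : ∀ x, (x = r ∨ x ∈ T₁ ∨ x ∈ T₂) → f x = c → x ∈ T₁ ∧ f₁ x = c := by
        rintro x (rfl | hx | hx) hxc
        · exact absurd (by rwa [← hxc, hfr] at hc) hq₁
        · exact ⟨hx, (hf₁ x hx).symm.trans hxc⟩
        · rcases hm₂ x hx with h | h
          · exact absurd (by rwa [← hxc, hf₂ x hx, h] at hc) hr₁
          · exact absurd (by rwa [← hf₂ x hx, hxc] at h) hc'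
      obtain ⟨hx, hx'⟩ := side x hx hxc
      obtain ⟨hy, hy'⟩ := side y hy hyc
      obtain ⟨hz, hz'⟩ := side z hz hzc
      exact hw₁ c hc x hx y hy z hz hx' hy' hz'
    · have hc' : c ∉ T₁ := fun h => hd' c h hc
      have side : ∀ x, (x = r ∨ x ∈ T₁ ∨ x ∈ T₂) → f x = c → x ∈ T₂ ∧ f₂ x = c := by
        rintro x (rfl | hx | hx) hxc
        · exact absurd (by rwa [← hxc, hfr] at hc) hq₂
        · rcases hm₁ x hx with h | h
          · exact absurd (by rwa [← hxc, hf₁ x hx, h] at hc) hr₂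
          · exact absurd (by rwa [← hf₁ x hx, hxc] at h) hc'
        · exact ⟨hx, (hf₂ x hx).symm.trans hxc⟩
      obtain ⟨hx, hx'⟩ := side x hx hxc
      obtain ⟨hy, hy'⟩ := side y hy hyc
      obtain ⟨hz, hz'⟩ := side z hz hzc
      exact hw₂ c hc x hx y hy z hz hx' hy' hz'
  · intro p hp
    simp only [Finset.mem_insert, Finset.mem_union] at hp
    rcases hp with rfl | hp | hp
    · rwa [htr]
    · rw [ht₁ p hp]; exact h₁.le p hp
    · rw [ht₂ p hp]; exact h₂.le p hp

lemma Wakeable.join_filter [DecidableEq X] {q r : X} {τ B : ℝ} {T : Finset X} (P : X → Prop)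
    [DecidablePred P] (hr : r ∈ T) (hq : q ∉ T)
    (h₁ : Wakeable r (τ + dist q r) B ((T.erase r).filter P))
    (h₂ : Wakeable r (τ + dist q r) B ((T.erase r).filter fun x => ¬ P x))
    (hB : τ + dist q r ≤ B) : Wakeable q τ B T := by
  have h := h₁.join h₂ (by rintro rfl; exact hq hr) (by simp [hq]) (by simp [hq]) (by simp)
    (by simp) (Finset.disjoint_filter_filter_not _ _ _) hB
  rwa [Finset.filter_union_filter_not_eq, Finset.insert_erase hr] at h

/-- A wakeable set of points different from the root yields a wake-up tree. -/
lemma Wakeable.exists_isWakeUpTree [DecidableEq X] {p₀ : X} {B : ℝ} {S : Finset X}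
    (hB : 0 ≤ B) (h : Wakeable p₀ 0 B (S.erase p₀)) :
    ∃ parent t, IsWakeUpTree dist p₀ S parent t ∧ ∀ p ∈ S, t p ≤ B := by
  obtain ⟨f, t, h⟩ := h
  have hm : ∀ p, p ∈ S → p ≠ p₀ → p ∈ S.erase p₀ := fun p h h' => Finset.mem_erase.2 ⟨h', h⟩
  refine ⟨f, t, ⟨h.root, ?_, ?_, ?_, ?_⟩, ?_⟩
  · intro p hp hp0
    refine ⟨(h.mem p (hm p hp hp0)).imp_right Finset.mem_of_mem_erase,
      h.time p (hm p hp hp0), ?_⟩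
    refine h.ind {p | ∃ n : ℕ, f^[n] p = p₀} ⟨0, rfl⟩ ?_ p (hm p hp hp0)
    rintro p - ⟨n, hn⟩
    exact ⟨n + 1, hn⟩
  · exact fun x hx hx0 hfx y hy hy0 hfy => h.one x (hm x hx hx0) y (hm y hy hy0) hfx hfy
  · rintro ⟨p, hp, hp0⟩
    by_contra! hc
    refine hp0 (h.ind {p₀} rfl ?_ p (hm p hp hp0))
    intro x hx hfx
    exact absurd hfx (hc x (Finset.mem_of_mem_erase hx) (Finset.ne_of_mem_erase hx))
  · exact fun q hq hq0 x hx y hy z hz hx0 hy0 hz0 =>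
      h.two q (hm q hq hq0) x (hm x hx hx0) y (hm y hy hy0) z (hm z hz hz0)
  · intro p hp
    by_cases hp0 : p = p₀
    · rw [hp0, h.root]; exact hB
    · exact h.le p (hm p hp hp0)

end Tree

section Sweep

variable {X : Type*} [MetricSpace X] {rad ang : X → ℝ}

/-- Angular sweep: always wake the point of least angle, then halve the range of radii. -/
lemma wakeable_sweep
    (hdist : ∀ x y, dist x y ≤ |rad x - rad y| + min (rad x) (rad y) * |ang x - ang y|)
    {Θ κ : ℝ} (hκ : 0 ≤ κ) (T : Finset X) : ∀ (q : X) (τ a w D : ℝ), q ∉ T → 0 ≤ w →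
    (∀ p ∈ T, ang q ≤ ang p ∧ ang p ≤ Θ ∧ a ≤ rad p ∧ rad p ≤ a + w ∧ |rad q - rad p| ≤ D) →
    a + w ≤ κ → Wakeable q τ (τ + D + 2 * w + κ * (Θ - ang q)) T := by
  classical
  induction T using Finset.strongInduction with
  | H T ih =>
    intro q τ a w D hq hw hT ha
    rcases T.eq_empty_or_nonempty with rfl | hne
    · exact wakeable_empty _ _ _
    obtain ⟨r, hr, hmin⟩ := T.exists_min_image ang hne
    obtain ⟨hr1, hr2, hr3, hr4, hr5⟩ := hT r hr
    have hdr : dist q r ≤ D + κ * (ang r - ang q) := by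
      refine (hdist q r).trans (add_le_add hr5 ?_)
      rw [abs_sub_comm, abs_of_nonneg (sub_nonneg.2 hr1)]
      exact mul_le_mul_of_nonneg_right ((min_le_right _ _).trans (by linarith))
        (sub_nonneg.2 hr1)
    have hΘ : 0 ≤ κ * (Θ - ang r) := mul_nonneg hκ (sub_nonneg.2 hr2)
    refine Wakeable.join_filter (fun x => rad x ≤ a + w / 2) hr hq ?_ ?_ (by linarith)
    · refine (ih _ ((Finset.filter_subset _ _).trans_ssubset (Finset.erase_ssubset hr))
        r _ a (w / 2) w (by simp) (by linarith) ?_ (by linarith)).mono (by linarith)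
      intro x hx
      obtain ⟨hx, hx'⟩ := Finset.mem_filter.1 hx
      have hxT := Finset.mem_of_mem_erase hx
      obtain ⟨h1, h2, h3, h4, h5⟩ := hT x hxT
      exact ⟨hmin x hxT, h2, h3, hx', abs_le.2 ⟨by linarith, by linarith⟩⟩
    · refine (ih _ ((Finset.filter_subset _ _).trans_ssubset (Finset.erase_ssubset hr))
        r _ (a + w / 2) (w / 2) w (by simp) (by linarith) ?_ (by linarith)).mono (by linarith)
      intro x hx
      obtain ⟨hx, hx'⟩ := Finset.mem_filter.1 hx
      have hxT := Finset.mem_of_mem_erase hx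
      obtain ⟨h1, h2, h3, h4, h5⟩ := hT x hxT
      exact ⟨hmin x hxT, h2, (not_le.1 hx').le, by linarith, abs_le.2 ⟨by linarith, by linarith⟩⟩

/-- Waking a half-disk from a point of least radius on its boundary; the first split of the
radii is at `3 / 5`. -/
lemma wakeable_halfDisk
    (hdist : ∀ x y, dist x y ≤ |rad x - rad y| + min (rad x) (rad y) * |ang x - ang y|)
    {T : Finset X} {p : X} (hp : p ∉ T) (hp0 : 0 ≤ rad p) (hpa : ang p = 0)
    (hT : ∀ x ∈ T, 0 ≤ ang x ∧ ang x ≤ Real.pi ∧ rad p ≤ rad x ∧ rad x ≤ 1) :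
    Wakeable p (rad p) 5.4162 T := by
  classical
  have hpi := Real.pi_lt_d2
  rcases T.eq_empty_or_nonempty with rfl | hne
  · exact wakeable_empty _ _ _
  obtain ⟨r, hr, hmin⟩ := T.exists_min_image ang hne
  obtain ⟨hr1, hr2, hr3, hr4⟩ := hT r hr
  have hdr : dist p r ≤ rad r - rad p + rad p * ang r := by
    have h := hdist p r
    rwa [abs_sub_comm, abs_of_nonneg (sub_nonneg.2 hr3), min_eq_left hr3, hpa, zero_sub, abs_neg,
      abs_of_nonneg hr1] at h
  have hdr1 : rad p * ang r ≤ ang r := mul_le_of_le_one_left hr1 (hr3.trans hr4)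
  refine Wakeable.join_filter (fun x => rad x ≤ 3 / 5) hr hp ?_ ?_ (by linarith)
  · rcases ((T.erase r).filter fun x => rad x ≤ 3 / 5).eq_empty_or_nonempty with h | ⟨y, hy⟩
    · rw [h]; exact wakeable_empty _ _ _
    obtain ⟨hy, hy'⟩ := Finset.mem_filter.1 hy
    have hpy := (hT y (Finset.mem_of_mem_erase hy)).2.2.1
    have hdr2 : rad p * ang r ≤ 3 / 5 * ang r :=
      mul_le_mul_of_nonneg_right (hpy.trans hy') hr1
    refine (wakeable_sweep hdist (Θ := Real.pi) (κ := 3 / 5) (by norm_num) _ r _ 0 (3 / 5)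
      (max (rad r) (3 / 5 - rad r)) (by simp) (by norm_num) ?_ (by norm_num)).mono ?_
    · intro x hx
      obtain ⟨hx, hx'⟩ := Finset.mem_filter.1 hx
      have hxT := Finset.mem_of_mem_erase hx
      obtain ⟨h1, h2, h3, h4⟩ := hT x hxT
      refine ⟨hmin x hxT, h2, hp0.trans h3, by linarith, ?_⟩
      rw [abs_le', le_max_iff, le_max_iff]
      exact ⟨Or.inl (by linarith), Or.inr (by linarith)⟩
    · rcases max_cases (rad r) (3 / 5 - rad r) with ⟨h, -⟩ | ⟨h, -⟩ <;> rw [h] <;> linarith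
  · refine (wakeable_sweep hdist (Θ := Real.pi) (κ := 1) (by norm_num) _ r _ (3 / 5) (2 / 5)
      (max (1 - rad r) (rad r - 3 / 5)) (by simp) (by norm_num) ?_ (by norm_num)).mono ?_
    · intro x hx
      obtain ⟨hx, hx'⟩ := Finset.mem_filter.1 hx
      have hxT := Finset.mem_of_mem_erase hx
      obtain ⟨h1, h2, h3, h4⟩ := hT x hxT
      refine ⟨hmin x hxT, h2, (not_le.1 hx').le, by linarith, ?_⟩
      rw [abs_le', le_max_iff, le_max_iff]
      exact ⟨Or.inr (by linarith), Or.inl (by linarith)⟩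
    · rcases max_cases (1 - rad r) (rad r - 3 / 5) with ⟨h, -⟩ | ⟨h, -⟩ <;> rw [h] <;> linarith

end Sweep

section Polar

open Complex

lemma norm_exp_mul_I_sub_exp_mul_I_le (α β : ℝ) :
    ‖exp (α * I) - exp (β * I)‖ ≤ |α - β| := by
  have h : exp (α * I) - exp (β * I) = exp (β * I) * (exp (I * (α - β : ℝ)) - 1) := by
    rw [mul_sub, ← exp_add, mul_one]
    congr 2
    push_cast
    ring
  rw [h, norm_mul, norm_exp_ofReal_mul_I, one_mul]
  exact Real.norm_exp_I_mul_ofReal_sub_one_le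

/-- Distance in polar coordinates: move radially, and turn at the smaller radius. -/
lemma norm_sub_le_polar (z w : ℂ) :
    ‖z - w‖ ≤ |‖z‖ - ‖w‖| + min ‖z‖ ‖w‖ * |arg z - arg w| := by
  wlog h : ‖z‖ ≤ ‖w‖ generalizing z w
  · have := this w z (le_of_not_ge h)
    rwa [norm_sub_rev, abs_sub_comm, min_comm, abs_sub_comm (arg z)]
  have hz := norm_mul_exp_arg_mul_I z
  have hw := norm_mul_exp_arg_mul_I w
  have hzw : z - w = ((‖z‖ - ‖w‖ : ℝ) : ℂ) * exp (arg w * I) +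
      (‖z‖ : ℂ) * (exp (arg z * I) - exp (arg w * I)) := by
    conv_lhs => rw [← hz, ← hw]
    push_cast
    ring
  rw [hzw]
  refine (norm_add_le _ _).trans ?_
  rw [norm_mul, norm_mul, norm_exp_ofReal_mul_I, mul_one, norm_real, norm_real, Real.norm_eq_abs,
    norm_norm, min_eq_left h]
  gcongr
  exact norm_exp_mul_I_sub_exp_mul_I_le _ _

/-- Polar coordinates of the plane with a prescribed direction of angle zero. -/
lemma exists_angle {p : EuclideanSpace ℝ (Fin 2)} (hp : p ≠ 0) :
    ∃ ang : EuclideanSpace ℝ (Fin 2) → ℝ, ang p = 0 ∧ (∀ x, |ang x| ≤ Real.pi) ∧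
      ∀ x y, dist x y ≤ |‖x‖ - ‖y‖| + min ‖x‖ ‖y‖ * |ang x - ang y| := by
  set φ := Complex.orthonormalBasisOneI.repr.symm
  set u : ℂ := φ p / ‖φ p‖ with hu
  have hp' : φ p ≠ 0 := by simpa using hp
  have hn : ‖φ p‖ ≠ 0 := norm_ne_zero_iff.2 hp'
  have hu1 : ‖u‖ = 1 := by rw [hu, norm_div, norm_real, norm_norm, div_self hn]
  have hnorm : ∀ x, ‖φ x / u‖ = ‖x‖ := fun x => by
    rw [norm_div, hu1, div_one, LinearIsometryEquiv.norm_map]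
  refine ⟨fun x => arg (φ x / u), ?_, fun x => abs_arg_le_pi _, fun x y => ?_⟩
  · have : φ p / u = (‖φ p‖ : ℝ) := by
      rw [hu, div_div_cancel₀ hp']
    change arg (φ p / u) = 0
    rw [this, arg_ofReal_of_nonneg (norm_nonneg _)]
  · have h := norm_sub_le_polar (φ x / u) (φ y / u)
    rwa [← sub_div, norm_div, hu1, div_one, ← map_sub, LinearIsometryEquiv.norm_map, hnorm, hnorm,
      ← dist_eq_norm] at h

end Polar

/-- any finite set of points in the closed Euclidean unit disk admits a
wake-up tree rooted at the origin with makespan at most `5.4162`. -/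
theorem freezeTag_unitDisk_makespan_le (S : Finset (EuclideanSpace ℝ (Fin 2)))
    (hS : ∀ p ∈ S, ‖p‖ ≤ 1) :
    ∃ (parent : EuclideanSpace ℝ (Fin 2) → EuclideanSpace ℝ (Fin 2))
      (t : EuclideanSpace ℝ (Fin 2) → ℝ),
      IsWakeUpTree dist (0 : EuclideanSpace ℝ (Fin 2)) S parent t ∧
      ∀ p ∈ S, t p ≤ 5.4162 := by
  classical
  refine Wakeable.exists_isWakeUpTree (by norm_num) ?_
  rcases (S.erase 0).eq_empty_or_nonempty with h | hne
  · rw [h]; exact wakeable_empty _ _ _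
  obtain ⟨p, hp, hmin⟩ := (S.erase 0).exists_min_image (fun x => ‖x‖) hne
  obtain ⟨ang, hang, hpi, hdist⟩ := exists_angle (Finset.ne_of_mem_erase hp)
  have hp1 := hS p (Finset.mem_of_mem_erase hp)
  have hτ : 0 + dist 0 p = ‖p‖ := by rw [zero_add, dist_zero_left]
  refine Wakeable.join_filter (fun x => 0 ≤ ang x) hp (by simp) ?_ ?_
    (by rw [hτ]; exact hp1.trans (by norm_num)) <;> rw [hτ]
  · refine wakeable_halfDisk hdist (by simp) (norm_nonneg p) hang fun x hx => ?_
    obtain ⟨hx, hx'⟩ := Finset.mem_filter.1 hx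
    have hxS := Finset.mem_of_mem_erase hx
    exact ⟨hx', (abs_le.1 (hpi x)).2, hmin x hxS, hS x (Finset.mem_of_mem_erase hxS)⟩
  · refine wakeable_halfDisk (rad := fun x => ‖x‖) (ang := fun x => -ang x)
      (fun x y => ?_) (by simp) (norm_nonneg p) (by simp [hang]) fun x hx => ?_
    · have h := hdist x y
      rwa [abs_sub_comm (ang x), show ang y - ang x = -ang x - -ang y by ring] at h
    · obtain ⟨hx, hx'⟩ := Finset.mem_filter.1 hx
      have hxS := Finset.mem_of_mem_erase hx
      exact ⟨by linarith, neg_le.1 (abs_le.1 (hpi x)).1, hmin x hxS,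
        hS x (Finset.mem_of_mem_erase hxS)⟩
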